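/- Let f : [0,∞) → ℝ be operator convex, let A_1,…,A_n be positive operators on H, and let C_1,…,C_n be operators on H with ∑_{i=1}^n C_i^*C_i = I and each C_i^*C_i invertible. Let {1,…,n} = S_1 ∪ S_2 be a partition into two disjoint nonempty sets and set C_{S_k} = ∑_{i∈S_k} C_i^*C_i (k = 1,2), assumed invertible. Then f(∑_{i=1}^n C_i^*A_iC_i) ≤ C_{S_1}^{1/2} f(C_{S_1}^{−1/2} (∑_{i∈S_1} C_i^*A_iC_i) C_{S_1}^{−1/2}) C_{S_1}^{1/2} + C_{S_2}^{1/2} f(C_{S_2}^{−1/2} (∑_{i∈S_2} C_i^*A_iC_i) C_{S_2}^{−1/2}) C_{S_2}^{1/2} ≤ ∑_{i=1}^n (C_i^*C_i)^{1/2} f((C_i^*C_i)^{−1/2} (C_i^*A_iC_i) (C_i^*C_i)^{−1/2}) (C_i^*C_i)^{1/2} ≤ ∑_{i=1}^n C_i^* f(A_i) C_i in the Loewner order. -/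

import Mathlib

open scoped InnerProductSpace

noncomputable section

/-- A continuous function `f : [0, ∞) → ℝ` is *operator convex* if for every complex Hilbert
space `K`, all selfadjoint operators `A, B` on `K` with spectra in `[0, ∞)` and every
`λ ∈ [0, 1]` one has `f(λA + (1-λ)B) ≤ λ f(A) + (1-λ) f(B)` in the Loewner order, where
`f(A)` is given by the continuous functional calculus. -/
def OperatorConvexOn (f : ℝ → ℝ) : Prop :=
  ∀ (K : Type) [NormedAddCommGroup K] [InnerProductSpace ℂ K] [CompleteSpace K],
    ∀ A B : K →L[ℂ] K, IsSelfAdjoint A → IsSelfAdjoint B →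
      spectrum ℝ A ⊆ Set.Ici (0 : ℝ) → spectrum ℝ B ⊆ Set.Ici (0 : ℝ) →
      ∀ lam : ℝ, lam ∈ Set.Icc (0 : ℝ) 1 →
        cfc f (lam • A + (1 - lam) • B) ≤ lam • cfc f A + (1 - lam) • cfc f B

variable {H : Type} [NormedAddCommGroup H] [InnerProductSpace ℂ H] [CompleteSpace H]

/-- `R^{1/2}` via the continuous functional calculus. -/
def opSqrt (R : H →L[ℂ] H) : H →L[ℂ] H := cfc Real.sqrt R

/-- `R^{-1/2}` via the continuous functional calculus. -/
def opInvSqrt (R : H →L[ℂ] H) : H →L[ℂ] H := cfc (fun t : ℝ => (Real.sqrt t)⁻¹) R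

/-- The non-commutative perspective `g(L, R) = R^{1/2} f(R^{-1/2} L R^{-1/2}) R^{1/2}`. -/
def persp (f : ℝ → ℝ) (L R : H →L[ℂ] H) : H →L[ℂ] H :=
  opSqrt R * cfc f (opInvSqrt R * L * opInvSqrt R) * opSqrt R

theorem norm_cfc_sub_aeval_le {G : Type*} [NormedAddCommGroup G] [InnerProductSpace ℂ G]
    [CompleteSpace G] {f : ℝ → ℝ} {R : ℝ} (hf : ContinuousOn f (Set.Icc 0 R)) {T : G →L[ℂ] G}
    (hT : IsSelfAdjoint T) (hTR : spectrum ℝ T ⊆ Set.Icc 0 R) {ε : ℝ} (hε : 0 < ε)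
    {p : Polynomial ℝ} (hp : ∀ x ∈ Set.Icc 0 R, |p.eval x - f x| < ε) :
    ‖cfc f T - Polynomial.aeval T p‖ ≤ ε := by
  rw [← cfc_polynomial p T, ← cfc_sub f p.eval T (hf.mono hTR) p.continuous.continuousOn]
  refine norm_cfc_le hε.le fun x hx ↦ ?_
  rw [Real.norm_eq_abs, abs_sub_comm]
  exact (hp x (hTR hx)).le

open ContinuousLinearMap in
/-- The continuous functional calculus of positive operators preserves intertwining relations. -/
theorem cfc_comp_eq_comp_cfc {E F : Type*} [NormedAddCommGroup E] [InnerProductSpace ℂ E]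
    [CompleteSpace E] [NormedAddCommGroup F] [InnerProductSpace ℂ F] [CompleteSpace F]
    {f : ℝ → ℝ} (hf : ContinuousOn f (Set.Ici (0 : ℝ))) {A : F →L[ℂ] F} {B : E →L[ℂ] E}
    (hA : 0 ≤ A) (hB : 0 ≤ B) {V : E →L[ℂ] F} (h : A ∘L V = V ∘L B) :
    cfc f A ∘L V = V ∘L cfc f B := by
  have hAs : IsSelfAdjoint A := .of_nonneg hA
  have hBs : IsSelfAdjoint B := .of_nonneg hB
  have hpow (k : ℕ) : (A ^ k) ∘L V = V ∘L (B ^ k) := by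
    induction k with
    | zero => ext x; simp
    | succ k ih =>
      ext x
      have h1 := DFunLike.congr_fun ih (B x)
      have h2 := DFunLike.congr_fun h x
      simp only [comp_apply] at h1 h2 ⊢
      rw [pow_succ, pow_succ, mul_apply_eq_comp, mul_apply_eq_comp, h2, h1]
  have hpoly (p : Polynomial ℝ) : (Polynomial.aeval A p) ∘L V = V ∘L (Polynomial.aeval B p) := by
    induction p using Polynomial.induction_on' with
    | add p q hp hq => rw [map_add, map_add, add_comp, comp_add, hp, hq]
    | monomial k a =>
      ext x
      have h1 := DFunLike.congr_fun (hpow k) x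
      simp only [comp_apply] at h1
      simp [Polynomial.aeval_monomial, Algebra.algebraMap_eq_smul_one, h1]
  obtain ⟨R, hR⟩ : ∃ R : ℝ, spectrum ℝ A ∪ spectrum ℝ B ⊆ Set.Icc 0 R := by
    obtain ⟨R, hR⟩ := ((spectrum.isCompact (𝕜 := ℝ) A).union
      (spectrum.isCompact (𝕜 := ℝ) B)).bddAbove
    refine ⟨R, fun x hx ↦ ⟨?_, hR hx⟩⟩
    rcases hx with hx | hx
    · exact spectrum_nonneg_of_nonneg hA hx
    · exact spectrum_nonneg_of_nonneg hB hx
  have hfR : ContinuousOn f (Set.Icc 0 R) := hf.mono Set.Icc_subset_Ici_self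
  rw [← sub_eq_zero, ← norm_le_zero_iff]
  refine le_of_forall_pos_le_add fun δ hδ ↦ ?_
  have hV : 0 < 2 * ‖V‖ + 1 := by positivity
  obtain ⟨p, hp⟩ := exists_polynomial_near_of_continuousOn 0 R f hfR (δ / (2 * ‖V‖ + 1))
    (by positivity)
  have h1 := norm_cfc_sub_aeval_le hfR hAs (Set.subset_union_left.trans hR) (by positivity) hp
  have h2 := norm_cfc_sub_aeval_le hfR hBs (Set.subset_union_right.trans hR) (by positivity) hp
  have key : cfc f A ∘L V - V ∘L cfc f B = (cfc f A - Polynomial.aeval A p) ∘L V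
      - V ∘L (cfc f B - Polynomial.aeval B p) := by
    rw [sub_comp, comp_sub, hpoly]; abel
  rw [key, zero_add]
  calc _ ≤ ‖cfc f A - Polynomial.aeval A p‖ * ‖V‖ + ‖V‖ * ‖cfc f B - Polynomial.aeval B p‖ :=
        (norm_sub_le _ _).trans (add_le_add (opNorm_comp_le _ _) (opNorm_comp_le _ _))
    _ ≤ δ / (2 * ‖V‖ + 1) * ‖V‖ + ‖V‖ * (δ / (2 * ‖V‖ + 1)) := by gcongr
    _ = δ * (2 * ‖V‖ / (2 * ‖V‖ + 1)) := by ring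
    _ ≤ δ * 1 := by gcongr; rw [div_le_one hV]; linarith
    _ = δ := mul_one δ

open ContinuousLinearMap in
/-- Jensen's operator inequality for compressions by an isometry. -/
theorem cfc_adjoint_conj_le {E F : Type} [NormedAddCommGroup E] [InnerProductSpace ℂ E]
    [CompleteSpace E] [NormedAddCommGroup F] [InnerProductSpace ℂ F] [CompleteSpace F]
    {f : ℝ → ℝ} (hfc : ContinuousOn f (Set.Ici (0 : ℝ))) (hf : OperatorConvexOn f)
    {A : F →L[ℂ] F} (hA : 0 ≤ A) {V : E →L[ℂ] F} (hV : adjoint V ∘L V = 1) :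
    cfc f (adjoint V ∘L A ∘L V) ≤ adjoint V ∘L cfc f A ∘L V := by
  have hVx (x : E) : adjoint V (V x) = x := DFunLike.congr_fun hV x
  set W : F →L[ℂ] F := (2 : ℂ) • (V ∘L adjoint V) - 1 with hW
  have hWs : star W = W := by
    rw [hW, star_sub, star_smul, star_one, star_eq_adjoint, adjoint_comp, adjoint_adjoint]
    simp
  have hWV (x : E) : W (V x) = V x := by simp [hW, hVx, two_smul]
  have hVW (y : F) : adjoint V (W y) = adjoint V y := by simp [hW, hVx, two_smul]
  have hWW : W * W = 1 := by
    ext y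
    simp [hW, hVx, two_smul]
  have hB : 0 ≤ W * A * W := by
    have := star_left_conjugate_nonneg hA W
    rwa [hWs] at this
  have hBf : cfc f (W * A * W) * W = W * cfc f A := by
    refine cfc_comp_eq_comp_cfc hfc hB hA (V := W) ?_
    change W * A * W * W = W * A
    rw [mul_assoc, hWW, mul_one]
  set M : F →L[ℂ] F := (1 / 2 : ℝ) • A + (1 - 1 / 2 : ℝ) • (W * A * W) with hM
  have hconv : cfc f M ≤ (1 / 2 : ℝ) • cfc f A + (1 - 1 / 2 : ℝ) • cfc f (W * A * W) :=
    hf F A (W * A * W) (.of_nonneg hA) (.of_nonneg hB) (fun x hx ↦ spectrum_nonneg_of_nonneg hA hx)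
      (fun x hx ↦ spectrum_nonneg_of_nonneg hB hx) _ ⟨by norm_num, by norm_num⟩
  have hM0 : 0 ≤ M := by
    refine add_nonneg (smul_nonneg (by norm_num) hA) (smul_nonneg (by norm_num) hB)
  have hN0 : 0 ≤ adjoint V ∘L A ∘L V := by
    rw [nonneg_iff_isPositive] at hA ⊢
    exact hA.adjoint_conj V
  have hMV : M ∘L V = V ∘L (adjoint V ∘L A ∘L V) := by
    ext x
    simp only [hM, comp_apply, add_apply, smul_apply, mul_apply_eq_comp, hWV]
    simp only [hW, sub_apply, smul_apply, comp_apply, one_apply_eq_self]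
    module
  have hMf := cfc_comp_eq_comp_cfc hfc hM0 hN0 hMV
  have hpos : (0 : E →L[ℂ] E) ≤ adjoint V ∘L ((1 / 2 : ℝ) • cfc f A +
      (1 - 1 / 2 : ℝ) • cfc f (W * A * W) - cfc f M) ∘L V := by
    rw [← sub_nonneg, nonneg_iff_isPositive] at hconv
    rw [nonneg_iff_isPositive]
    exact hconv.adjoint_conj V
  rw [← sub_nonneg]
  convert hpos using 1
  ext x
  have h1 := DFunLike.congr_fun hMf x
  have h2 := DFunLike.congr_fun hBf (V x)
  simp only [comp_apply, mul_apply_eq_comp, hWV] at h1 h2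
  simp only [comp_apply, sub_apply, add_apply, smul_apply, map_sub, map_add, h1, h2, hVx]
  rw [map_smul_of_tower, map_smul_of_tower, hVW]
  module

open ContinuousLinearMap in
theorem PiLp.adjoint_proj_apply {ι : Type} [Fintype ι] [DecidableEq ι] (i : ι) (x : H) :
    adjoint (PiLp.proj (𝕜 := ℂ) 2 (fun _ : ι ↦ H) i) x = WithLp.toLp 2 (Pi.single i x) := by
  refine ext_inner_right ℂ fun y ↦ ?_
  rw [adjoint_inner_left, PiLp.inner_apply, Finset.sum_eq_single i]
  · simp
  · intro j _ hj
    simp [Pi.single_eq_of_ne hj]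
  · simp

open ContinuousLinearMap in
/-- Jensen's operator inequality for finite families. -/
theorem cfc_sum_conj_le {ι : Type} [Fintype ι] {f : ℝ → ℝ}
    (hfc : ContinuousOn f (Set.Ici (0 : ℝ))) (hf : OperatorConvexOn f)
    {A C : ι → H →L[ℂ] H} (hA : ∀ i, 0 ≤ A i) (hC : ∑ i, star (C i) * C i = 1) :
    cfc f (∑ i, star (C i) * A i * C i) ≤ ∑ i, star (C i) * cfc f (A i) * C i := by
  classical
  let P (i : ι) : PiLp 2 (fun _ : ι ↦ H) →L[ℂ] H := PiLp.proj (𝕜 := ℂ) 2 (fun _ : ι ↦ H) i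
  have hP (i j : ι) (x : H) : P i (adjoint (P j) x) = if i = j then x else 0 := by
    simp only [P]
    rw [PiLp.adjoint_proj_apply, PiLp.proj_apply]
    simp [Pi.single_apply]
  let V : H →L[ℂ] PiLp 2 (fun _ : ι ↦ H) := ∑ i, adjoint (P i) ∘L C i
  have hVadj : adjoint V = ∑ i, adjoint (C i) ∘L P i := by
    simp [V, adjoint_comp]
  let D : PiLp 2 (fun _ : ι ↦ H) →L[ℂ] PiLp 2 (fun _ : ι ↦ H) :=
    ∑ i, adjoint (P i) ∘L A i ∘L P i
  have hD : 0 ≤ D := by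
    refine Finset.sum_nonneg fun i _ ↦ ?_
    have := hA i
    rw [nonneg_iff_isPositive] at this ⊢
    exact this.adjoint_conj (P i)
  have hDP (i : ι) : D ∘L adjoint (P i) = adjoint (P i) ∘L A i := by
    ext1 x
    simp only [D, comp_apply, sum_apply, hP]
    rw [Finset.sum_eq_single i] <;> simp +contextual
  have hV : adjoint V ∘L V = 1 := by
    rw [← hC, hVadj]
    ext x
    simp [V, hP, star_eq_adjoint, apply_ite]
  have hfD (i : ι) (x : H) : cfc f D (adjoint (P i) x) = adjoint (P i) (cfc f (A i) x) :=
    DFunLike.congr_fun (cfc_comp_eq_comp_cfc hfc hD (hA i) (hDP i)) x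
  have hDV (i : ι) (x : H) : D (adjoint (P i) x) = adjoint (P i) (A i x) :=
    DFunLike.congr_fun (hDP i) x
  convert cfc_adjoint_conj_le hfc hf hD hV using 1
  · congr 1
    rw [hVadj]
    ext x
    simp [V, hP, hDV, star_eq_adjoint, apply_ite]
  · rw [hVadj]
    ext x
    simp [V, hP, hfD, star_eq_adjoint, apply_ite]

theorem star_opSqrt (R : H →L[ℂ] H) : star (opSqrt R) = opSqrt R :=
  (cfc_predicate Real.sqrt R : IsSelfAdjoint _).star_eq

theorem star_opInvSqrt (R : H →L[ℂ] H) : star (opInvSqrt R) = opInvSqrt R :=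
  (cfc_predicate (fun t : ℝ ↦ (Real.sqrt t)⁻¹) R : IsSelfAdjoint _).star_eq

theorem opSqrt_mul_self {R : H →L[ℂ] H} (hR : 0 ≤ R) : opSqrt R * opSqrt R = R := by
  unfold opSqrt
  rw [← cfc_mul Real.sqrt Real.sqrt R]
  conv_rhs => rw [← cfc_id ℝ R (.of_nonneg hR)]
  exact cfc_congr fun x hx ↦ Real.mul_self_sqrt (spectrum_nonneg_of_nonneg hR hx)

theorem opSqrt_mul_opInvSqrt {R : H →L[ℂ] H} (hR : 0 ≤ R) (hu : IsUnit R) :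
    opSqrt R * opInvSqrt R = 1 := by
  have hpos : ∀ x ∈ spectrum ℝ R, √x ≠ 0 := fun x hx ↦ by
    refine (Real.sqrt_pos.2 ((spectrum_nonneg_of_nonneg hR hx).lt_of_ne ?_)).ne'
    rintro rfl
    exact spectrum.zero_notMem ℝ hu hx
  unfold opSqrt opInvSqrt
  rw [← cfc_mul Real.sqrt (fun t : ℝ ↦ (Real.sqrt t)⁻¹) R (by fun_prop)
    (Real.continuous_sqrt.continuousOn.inv₀ hpos), ← cfc_one ℝ R (.of_nonneg hR)]
  exact cfc_congr fun x hx ↦ mul_inv_cancel₀ (hpos x hx)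

theorem opInvSqrt_mul_opSqrt {R : H →L[ℂ] H} (hR : 0 ≤ R) (hu : IsUnit R) :
    opInvSqrt R * opSqrt R = 1 := by
  simpa [star_opSqrt, star_opInvSqrt] using congrArg star (opSqrt_mul_opInvSqrt hR hu)

theorem opInvSqrt_conj_self {R : H →L[ℂ] H} (hR : 0 ≤ R) (hu : IsUnit R) :
    opInvSqrt R * R * opInvSqrt R = 1 := by
  have h : opInvSqrt R * R = opInvSqrt R * (opSqrt R * opSqrt R) := by rw [opSqrt_mul_self hR]
  rw [h, ← mul_assoc, opInvSqrt_mul_opSqrt hR hu, one_mul, opSqrt_mul_opInvSqrt hR hu]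

theorem opInvSqrt_conj_nonneg {L : H →L[ℂ] H} (hL : 0 ≤ L) (R : H →L[ℂ] H) :
    0 ≤ opInvSqrt R * L * opInvSqrt R := by
  simpa [star_opInvSqrt] using star_left_conjugate_nonneg hL (opInvSqrt R)

theorem opSqrt_conj_opInvSqrt_conj {R : H →L[ℂ] H} (hR : 0 ≤ R) (hu : IsUnit R)
    (X : H →L[ℂ] H) : opSqrt R * (opInvSqrt R * X * opInvSqrt R) * opSqrt R = X := by
  rw [mul_assoc, mul_assoc, opInvSqrt_mul_opSqrt hR hu, mul_one, ← mul_assoc,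
    opSqrt_mul_opInvSqrt hR hu, one_mul]

theorem opSqrt_conj_le {X Y : H →L[ℂ] H} (h : X ≤ Y) (R : H →L[ℂ] H) :
    opSqrt R * X * opSqrt R ≤ opSqrt R * Y * opSqrt R := by
  simpa [star_opSqrt] using star_left_conjugate_le_conjugate h (opSqrt R)

theorem persp_one (f : ℝ → ℝ) (L : H →L[ℂ] H) : persp f L 1 = cfc f L := by
  simp [persp, opSqrt, opInvSqrt, cfc_apply_one]

/-- The perspective of an operator convex function is jointly subadditive. -/
theorem persp_sum_le {ι : Type} [Fintype ι] {f : ℝ → ℝ}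
    (hfc : ContinuousOn f (Set.Ici (0 : ℝ))) (hf : OperatorConvexOn f)
    {L R : ι → H →L[ℂ] H} (hL : ∀ i, 0 ≤ L i) (hR : ∀ i, 0 ≤ R i) (hu : ∀ i, IsUnit (R i))
    (hsum : IsUnit (∑ i, R i)) :
    persp f (∑ i, L i) (∑ i, R i) ≤ ∑ i, persp f (L i) (R i) := by
  have hS : 0 ≤ ∑ i, R i := Finset.sum_nonneg fun i _ ↦ hR i
  set S := ∑ i, R i
  have hconj (i : ι) (X : H →L[ℂ] H) : star (opSqrt (R i) * opInvSqrt S) * X *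
      (opSqrt (R i) * opInvSqrt S) = opInvSqrt S * (opSqrt (R i) * X * opSqrt (R i)) *
        opInvSqrt S := by
    simp only [star_mul, star_opSqrt, star_opInvSqrt, mul_assoc]
  have hone : ∑ i, star (opSqrt (R i) * opInvSqrt S) * (opSqrt (R i) * opInvSqrt S) = 1 := by
    calc _ = ∑ i, opInvSqrt S * R i * opInvSqrt S := Finset.sum_congr rfl fun i _ ↦ by
          have := hconj i 1
          rwa [mul_one, mul_one, opSqrt_mul_self (hR i)] at this
      _ = 1 := by rw [← Finset.sum_mul, ← Finset.mul_sum, opInvSqrt_conj_self hS hsum]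
  have key := cfc_sum_conj_le hfc hf (fun i ↦ opInvSqrt_conj_nonneg (hL i) (R i)) hone
  simp only [hconj, opSqrt_conj_opInvSqrt_conj (hR _) (hu _)] at key
  rw [← Finset.sum_mul, ← Finset.mul_sum, ← Finset.sum_mul, ← Finset.mul_sum] at key
  have := opSqrt_conj_le key S
  rwa [opSqrt_conj_opInvSqrt_conj hS hsum] at this

theorem persp_star_conj_le {f : ℝ → ℝ} (hfc : ContinuousOn f (Set.Ici (0 : ℝ)))
    (hf : OperatorConvexOn f) {A C : H →L[ℂ] H} (hA : 0 ≤ A) (hu : IsUnit (star C * C)) :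
    persp f (star C * A * C) (star C * C) ≤ star C * cfc f A * C := by
  have hR : 0 ≤ star C * C := star_mul_self_nonneg C
  set R := star C * C with hRdef
  have hconj (X : H →L[ℂ] H) : star (C * opInvSqrt R) * X * (C * opInvSqrt R) =
      opInvSqrt R * (star C * X * C) * opInvSqrt R := by
    simp only [star_mul, star_opInvSqrt, mul_assoc]
  have hone : star (C * opInvSqrt R) * (C * opInvSqrt R) = 1 := by
    have := hconj 1
    rwa [mul_one, mul_one, ← hRdef, opInvSqrt_conj_self hR hu] at this
  have key := cfc_adjoint_conj_le hfc hf hA (V := C * opInvSqrt R) hone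
  change cfc f (star (C * opInvSqrt R) * (A * (C * opInvSqrt R))) ≤
    star (C * opInvSqrt R) * (cfc f A * (C * opInvSqrt R)) at key
  rw [← mul_assoc (star _) A, ← mul_assoc (star _) (cfc f A), hconj, hconj] at key
  have := opSqrt_conj_le key R
  rwa [opSqrt_conj_opInvSqrt_conj hR hu] at this

/-- Refinement of the Jensen operator inequality for operators `C i` with
`∑ i, (C i)* (C i) = 1`. -/
theorem stmt_16 (f : ℝ → ℝ) (hf_cont : ContinuousOn f (Set.Ici (0 : ℝ)))
    (hf : OperatorConvexOn f) (n : ℕ)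
    (A C : Fin n → H →L[ℂ] H) (hA : ∀ i, 0 ≤ A i)
    (hC : ∑ i, star (C i) * C i = 1) (hCu : ∀ i, IsUnit (star (C i) * C i))
    (S₁ S₂ : Finset (Fin n)) (hdisj : Disjoint S₁ S₂) (hcover : S₁ ∪ S₂ = Finset.univ)
    (hne₁ : S₁.Nonempty) (hne₂ : S₂.Nonempty)
    (hC₁ : IsUnit (∑ i ∈ S₁, star (C i) * C i)) (hC₂ : IsUnit (∑ i ∈ S₂, star (C i) * C i)) :
    cfc f (∑ i, star (C i) * A i * C i) ≤
        persp f (∑ i ∈ S₁, star (C i) * A i * C i) (∑ i ∈ S₁, star (C i) * C i) +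
          persp f (∑ i ∈ S₂, star (C i) * A i * C i) (∑ i ∈ S₂, star (C i) * C i) ∧
      persp f (∑ i ∈ S₁, star (C i) * A i * C i) (∑ i ∈ S₁, star (C i) * C i) +
          persp f (∑ i ∈ S₂, star (C i) * A i * C i) (∑ i ∈ S₂, star (C i) * C i) ≤
        ∑ i, persp f (star (C i) * A i * C i) (star (C i) * C i) ∧
      (∑ i, persp f (star (C i) * A i * C i) (star (C i) * C i)) ≤
        ∑ i, star (C i) * cfc f (A i) * C i := by
  have hL (i : Fin n) : 0 ≤ star (C i) * A i * C i := star_left_conjugate_nonneg (hA i) (C i)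
  have hR (i : Fin n) : 0 ≤ star (C i) * C i := star_mul_self_nonneg (C i)
  have hsplit (X : Fin n → H →L[ℂ] H) : ∑ i, X i = ∑ i ∈ S₁, X i + ∑ i ∈ S₂, X i := by
    rw [← hcover, Finset.sum_union hdisj]
  have hS (S : Finset (Fin n)) (hu : IsUnit (∑ i ∈ S, star (C i) * C i)) :
      persp f (∑ i ∈ S, star (C i) * A i * C i) (∑ i ∈ S, star (C i) * C i) ≤
        ∑ i ∈ S, persp f (star (C i) * A i * C i) (star (C i) * C i) := by
    have hu' := hu
    rw [← Finset.sum_coe_sort] at hu'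
    have := persp_sum_le (ι := S) hf_cont hf (fun i ↦ hL i) (fun i ↦ hR i) (fun i ↦ hCu i) hu'
    rwa [Finset.sum_coe_sort S fun i ↦ star (C i) * A i * C i,
      Finset.sum_coe_sort S fun i ↦ star (C i) * C i,
      Finset.sum_coe_sort S fun i ↦ persp f (star (C i) * A i * C i) (star (C i) * C i)] at this
  refine ⟨?_, ?_, Finset.sum_le_sum fun i _ ↦ persp_star_conj_le hf_cont hf (hA i) (hCu i)⟩
  · let T (b : Bool) : Finset (Fin n) := if b then S₁ else S₂
    have hone : ∑ b, ∑ i ∈ T b, star (C i) * C i = 1 := by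
      rw [← hC, hsplit, Fintype.sum_bool]
      rfl
    have := persp_sum_le (ι := Bool) hf_cont hf
      (L := fun b ↦ ∑ i ∈ T b, star (C i) * A i * C i)
      (R := fun b ↦ ∑ i ∈ T b, star (C i) * C i)
      (fun b ↦ Finset.sum_nonneg fun i _ ↦ hL i) (fun b ↦ Finset.sum_nonneg fun i _ ↦ hR i)
      (by rintro (_ | _); exacts [hC₂, hC₁]) (hone ▸ isUnit_one)
    rw [hone, persp_one, Fintype.sum_bool, Fintype.sum_bool] at this
    rw [hsplit fun i ↦ star (C i) * A i * C i]
    exact this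
  · rw [hsplit]
    exact add_le_add (hS S₁ hC₁) (hS S₂ hC₂)
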